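/- arXiv:1202.3670 — 9 statements merged into one kernel-verified Lean document; each statement's English description precedes it below -/
import Mathlib

section
/- Let a and c be nonzero integers and let b ≥ 2 be an integer. Then the set of primes p such that p divides a·b^k + c for some nonnegative integer k with a·b^k + c ≠ 0 is infinite. -/
/-- Every nonzero integer is the product of a divisor of a power of `b` and an integer
coprime to `b`. -/
theorem Int.exists_eq_mul_dvd_pow_isCoprime (b : ℤ) {x : ℤ} (hx : x ≠ 0) :
    ∃ (r : ℕ) (y z : ℤ), x = y * z ∧ y ∣ b ^ r ∧ IsCoprime z b := by
  induction x using UniqueFactorizationMonoid.induction_on_prime with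
  | h₁ => exact absurd rfl hx
  | h₂ x hu =>
    obtain ⟨v, hv⟩ := hu.exists_left_inv
    exact ⟨0, 1, x, by simp, by simp, v, 0, by simp [hv]⟩
  | h₃ x p hx' hp ih =>
    obtain ⟨r, y, z, rfl, hy, hz⟩ := ih hx'
    by_cases hpb : p ∣ b
    · exact ⟨r + 1, p * y, z, by ring, by rw [pow_succ']; exact mul_dvd_mul hpb hy, hz⟩
    · exact ⟨r, y, p * z, by ring, hy, ((hp.irreducible.coprime_iff_not_dvd).2 hpb).mul_left hz⟩

/-- Euler's theorem for integers, with an unspecified positive exponent. -/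
theorem IsCoprime.exists_pos_dvd_pow_sub_one {n b : ℤ} (hn : n ≠ 0) (h : IsCoprime n b) :
    ∃ m : ℕ, 0 < m ∧ n ∣ b ^ m - 1 := by
  refine ⟨n.natAbs.totient, Nat.totient_pos.2 (Int.natAbs_pos.2 hn), ?_⟩
  rw [← Int.natAbs_dvd, ← ZMod.intCast_zmod_eq_zero_iff_dvd]
  have hu : IsUnit ((b : ℤ) : ZMod n.natAbs) := by
    obtain ⟨u, v, huv⟩ := h
    have := congrArg (Int.cast : ℤ → ZMod n.natAbs) huv
    have hz : ((n : ℤ) : ZMod n.natAbs) = 0 := by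
      rw [ZMod.intCast_zmod_eq_zero_iff_dvd, Int.natAbs_dvd]
    push_cast at this
    rw [hz, mul_zero, zero_add] at this
    exact IsUnit.of_mul_eq_one_right _ this
  obtain ⟨w, hw⟩ := hu
  have := congrArg Units.val (ZMod.pow_totient w)
  push_cast at this ⊢
  rw [← hw, this, sub_self]

/-- Pólya's theorem: for nonzero integers `a`, `c` and an integer `b ≥ 2`, the set of
primes dividing some nonzero value `a·b^k + c` (`k ≥ 0`) is infinite. -/
theorem polya_prime_divisors_of_exponential (a c b : ℤ) (ha : a ≠ 0) (hc : c ≠ 0)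
    (hb : 2 ≤ b) :
    {p : ℕ | p.Prime ∧ ∃ k : ℕ, a * b ^ k + c ≠ 0 ∧ (p : ℤ) ∣ a * b ^ k + c}.Infinite := by
  intro hfin
  set P : ℤ := ∏ p ∈ hfin.toFinset, (p : ℤ)
  have hP0 : P ≠ 0 := by
    refine Finset.prod_ne_zero_iff.2 fun p hp => ?_
    exact_mod_cast ((hfin.mem_toFinset.1 hp).1).ne_zero
  obtain ⟨r, c₁, c₂, hc₁₂, hc₁, hc₂⟩ := Int.exists_eq_mul_dvd_pow_isCoprime b hc
  obtain ⟨s, P₁, P₂, hP₁₂, hP₁, hP₂⟩ := Int.exists_eq_mul_dvd_pow_isCoprime b hP0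
  obtain ⟨k, hk, hk'⟩ : ∃ k : ℕ, r + s + 1 ≤ k ∧ 2 * c.natAbs ≤ k :=
    ⟨max (r + s + 1) (2 * c.natAbs), le_max_left _ _, le_max_right _ _⟩
  have hlarge : ∀ j, k ≤ j → 2 * |c| < |a * b ^ j| := by
    intro j hj
    have h1 : (j : ℤ) < b ^ j := by
      have h2 : (j : ℤ) < 2 ^ j := by exact_mod_cast Nat.lt_two_pow_self
      exact h2.trans_le (pow_le_pow_left₀ (by norm_num) hb j)
    have h3 : 1 ≤ |a| := Int.one_le_abs ha
    have h4 : |b ^ j| = b ^ j := abs_of_nonneg (by positivity)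
    rw [abs_mul, h4]
    have h5 : b ^ j ≤ |a| * b ^ j := le_mul_of_one_le_left (by positivity) h3
    have h6 : (c.natAbs : ℤ) = |c| := Int.natCast_natAbs c
    have h7 : 2 * (c.natAbs : ℤ) ≤ j := by exact_mod_cast hk'.trans hj
    linarith
  have hne : ∀ j, k ≤ j → a * b ^ j + c ≠ 0 := by
    intro j hj h
    have := hlarge j hj
    rw [eq_neg_of_add_eq_zero_left h, abs_neg] at this
    have := abs_nonneg c
    omega
  obtain ⟨n, hn, hnb⟩ : ∃ n, a * b ^ k + c = c₁ * n ∧ IsCoprime n b := by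
    obtain ⟨t, ht⟩ := hc₁
    refine ⟨c₂ + b * (a * t * b ^ (k - r - 1)), ?_, hc₂.add_mul_left_left _⟩
    have : b ^ k = b ^ r * b * b ^ (k - r - 1) := by
      rw [← pow_succ, ← pow_add]; congr 1; omega
    rw [this, ht, hc₁₂]; ring
  have hn0 : n * P₂ ≠ 0 := by
    refine mul_ne_zero ?_ ?_
    · rintro rfl
      exact hne k le_rfl (by simpa using hn)
    · rintro rfl
      exact hP0 (by simpa using hP₁₂)
  obtain ⟨m, hm, hdvd⟩ := (hnb.mul_left hP₂).exists_pos_dvd_pow_sub_one hn0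
  have hkey : (a * b ^ k + c) * P ∣ a * b ^ k * (b ^ m - 1) := by
    have h1 : c₁ * P₁ ∣ a * b ^ k := by
      refine Dvd.dvd.mul_left ((mul_dvd_mul hc₁ hP₁).trans ?_) a
      rw [← pow_add]
      exact pow_dvd_pow b (by omega)
    have h2 : (a * b ^ k + c) * P = c₁ * P₁ * (n * P₂) := by rw [hn, hP₁₂]; ring
    rw [h2]
    exact mul_dvd_mul h1 hdvd
  obtain ⟨t, ht⟩ := hkey
  have hV : a * b ^ (k + m) + c = (a * b ^ k + c) * (1 + P * t) := by
    rw [pow_add]; linear_combination ht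
  have hunit : (1 + P * t).natAbs = 1 := by
    by_contra hne1
    obtain ⟨p, hp, hpd⟩ := Nat.exists_prime_and_dvd hne1
    rw [← Int.natCast_dvd] at hpd
    have hmem : p ∈ hfin.toFinset :=
      hfin.mem_toFinset.2 ⟨hp, k + m, hne _ (by omega), hV ▸ hpd.mul_left _⟩
    have hpP : (p : ℤ) ∣ P := Finset.dvd_prod_of_mem (fun q : ℕ => (q : ℤ)) hmem
    have h1 : (p : ℤ) ∣ 1 := (dvd_add_left (hpP.mul_right t)).1 hpd
    exact hp.one_lt.ne' (by exact_mod_cast Int.eq_one_of_dvd_one (by positivity) h1)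
  have hbm : 2 ≤ b ^ m := hb.trans (le_self_pow₀ (by omega) hm.ne')
  have hak := hlarge k le_rfl
  have hak0 : a * b ^ k ≠ 0 := mul_ne_zero ha (by positivity)
  rw [pow_add, ← mul_assoc] at hV
  rcases Int.natAbs_eq_iff.1 hunit with h | h <;> rw [h] at hV
  · have : a * b ^ k * (b ^ m - 1) = 0 := by push_cast at hV; linear_combination hV
    rcases mul_eq_zero.1 this with h | h
    · exact hak0 h
    · omega
  · have h1 : a * b ^ k * (b ^ m + 1) = -(2 * c) := by push_cast at hV; linear_combination hV
    have h2 := congrArg abs h1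
    rw [abs_mul, abs_neg, abs_mul 2, abs_two, abs_of_pos (by omega : 0 < b ^ m + 1)] at h2
    nlinarith [abs_nonneg (a * b ^ k)]
end

section
/- For every prime p > 5, every prime divisor q of the Fibonacci number F_p satisfies q > p. -/
theorem Nat.cast_fib_mul_sub_eq_pow_sub_pow {R : Type*} [CommRing R] {a b : R}
    (ha : a ^ 2 = a + 1) (hb : b ^ 2 = b + 1) (n : ℕ) :
    (Nat.fib n : R) * (a - b) = a ^ n - b ^ n := by
  induction n using Nat.twoStepInduction with
  | zero => simp
  | one => simp
  | more n h₀ h₁ =>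
    rw [Nat.fib_add_two, Nat.cast_add]
    linear_combination h₀ + h₁ - a ^ n * ha + b ^ n * hb

/-- Cassini's identity in a commutative ring. -/
theorem Nat.cast_fib_mul_cast_fib_add_two (R : Type*) [CommRing R] (n : ℕ) :
    (Nat.fib n : R) * Nat.fib (n + 2) = (Nat.fib (n + 1) : R) ^ 2 + (-1) ^ (n + 1) := by
  induction n with
  | zero => simp
  | succ n ih =>
    have h : (Nat.fib (n + 1 + 2) : R) = Nat.fib (n + 1) + Nat.fib (n + 2) := by
      rw [Nat.fib_add_two, Nat.cast_add]
    have h' : (Nat.fib (n + 2) : R) = Nat.fib n + Nat.fib (n + 1) := by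
      rw [Nat.fib_add_two, Nat.cast_add]
    rw [h]
    linear_combination -ih - Nat.fib (n + 2) * h'

theorem ZMod.sq_fib_self_eq_one {q : ℕ} [Fact q.Prime] (hq : q ≠ 5) :
    (Nat.fib q : ZMod q) ^ 2 = 1 := by
  have h5 : (5 : ZMod q) ≠ 0 := by
    intro h
    have h' : ((5 : ℕ) : ZMod q) = 0 := mod_cast h
    rw [ZMod.natCast_eq_zero_iff] at h'
    exact hq ((Nat.prime_dvd_prime_iff_eq Fact.out Nat.prime_five).1 h')
  let K := AlgebraicClosure (ZMod q)
  have : CharP K q := charP_of_injective_algebraMap (algebraMap (ZMod q) K).injective q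
  obtain ⟨a, ha⟩ := IsAlgClosed.exists_root
    (Polynomial.X ^ 2 - Polynomial.X - 1 : Polynomial K) (by
      have : (Polynomial.X ^ 2 - Polynomial.X - 1 : Polynomial K).degree = 2 := by
        compute_degree!
      simp [this])
  have ha : a ^ 2 = a + 1 := by
    simp only [Polynomial.IsRoot, Polynomial.eval_sub, Polynomial.eval_pow, Polynomial.eval_X,
      Polynomial.eval_one] at ha
    linear_combination ha
  have hbinet := Nat.cast_fib_mul_sub_eq_pow_sub_pow ha
    (b := 1 - a) (by linear_combination ha) q
  rw [← sub_pow_char] at hbinet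
  have hsq : (a - (1 - a)) ^ 2 = 5 := by linear_combination 4 * ha
  have hK : (Nat.fib q : K) ^ 2 * 5 = 5 ^ q := by
    rw [← hsq, ← mul_pow, hbinet, ← pow_mul, ← pow_mul, mul_comm]
  have hZ : (Nat.fib q : ZMod q) ^ 2 * 5 = 5 ^ q := by
    apply (algebraMap (ZMod q) K).injective
    simpa only [map_mul, map_pow, map_natCast, map_ofNat] using hK
  rw [ZMod.pow_card] at hZ
  exact mul_right_cancel₀ h5 (by rw [hZ, one_mul])

theorem Nat.Prime.dvd_fib_pred_or_dvd_fib_succ {q : ℕ} (hq : q.Prime) (hq5 : q ≠ 5) :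
    q ∣ Nat.fib (q - 1) ∨ q ∣ Nat.fib (q + 1) := by
  have : Fact q.Prime := ⟨hq⟩
  have h := Nat.cast_fib_mul_cast_fib_add_two (ZMod q) (q - 1)
  rw [show q - 1 + 2 = q + 1 by have := hq.pos; omega, Nat.sub_add_cancel hq.one_le,
    ZMod.sq_fib_self_eq_one hq5, ZMod.pow_card, add_neg_cancel, ← Nat.cast_mul,
    ZMod.natCast_eq_zero_iff] at h
  exact hq.dvd_mul.1 h

theorem Nat.Prime.dvd_of_dvd_fib {p q m : ℕ} (hp : p.Prime) (hq : q.Prime)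
    (hqp : q ∣ Nat.fib p) (hqm : q ∣ Nat.fib m) : p ∣ m := by
  by_contra h
  have hgcd := Nat.dvd_gcd hqp hqm
  rw [← Nat.fib_gcd, (hp.coprime_iff_not_dvd.2 h).gcd_eq_one, Nat.fib_one] at hgcd
  exact hq.not_dvd_one hgcd

/-- Mohanty's theorem: for every prime `p > 5`, every prime divisor `q`
of the Fibonacci number `F_p` satisfies `q > p`. -/
theorem mohanty_fib_prime_divisor (p q : ℕ) (hp : p.Prime) (hp5 : 5 < p)
    (hq : q.Prime) (hdvd : q ∣ Nat.fib p) :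
    p < q := by
  by_contra! hle
  have hq2 := hq.two_le
  by_cases hq5 : q = 5
  · subst hq5
    have := Nat.le_of_dvd (by norm_num) (hp.dvd_of_dvd_fib hq hdvd (m := 5) (by decide))
    omega
  rcases hq.dvd_fib_pred_or_dvd_fib_succ hq5 with h | h
  · have := Nat.le_of_dvd (by omega) (hp.dvd_of_dvd_fib hq hdvd h)
    omega
  · have hpq := hp.dvd_of_dvd_fib hq hdvd h
    have := Nat.le_of_dvd (by omega) hpq
    rcases hle.eq_or_lt with rfl | hlt
    · exact hq.not_dvd_one ((Nat.dvd_add_right dvd_rfl).1 hpq)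
    · have hp_odd := hp.eq_two_or_odd
      have hq_odd := hq.eq_two_or_odd
      omega
end

section
/- For all positive integers k and n with n ≥ 2k, the binomial coefficient C(n, k) has a prime divisor greater than k. -/
open Finset in
/-- Upper bound for a binomial coefficient whose prime factors above `s` occur at most once
and do not exceed `M`. -/
theorem choose_le_pow_primeCounting_mul_primorial {n k s M : ℕ} (hkn : k ≤ n) (hn : 0 < n)
    (h : ∀ p : ℕ, p.Prime → s < p → (n.choose k).factorization p ≤ 1 ∧
      (M < p → (n.choose k).factorization p = 0)) :
    n.choose k ≤ n ^ Nat.primeCounting s * primorial M := by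
  have prod_ite_le (f : ℕ → ℕ) (hf : ∀ p, p.Prime → 1 ≤ f p) (m : ℕ) :
      ∏ p ∈ range (n + 1), (if p.Prime ∧ p ≤ m then f p else 1) ≤
        ∏ p ∈ range (m + 1) with p.Prime, f p := by
    rw [← prod_filter]
    refine prod_le_prod_of_subset_of_one_le' (fun p hp ↦ ?_) fun p hp _ ↦ hf p (mem_filter.1 hp).2
    simp only [mem_filter, mem_range] at hp ⊢
    exact ⟨by omega, hp.2.1⟩
  calc
    n.choose k = ∏ p ∈ range (n + 1), p ^ (n.choose k).factorization p :=
      (Nat.prod_pow_factorization_choose n k hkn).symm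
    _ ≤ ∏ p ∈ range (n + 1), (if p.Prime ∧ p ≤ s then n else 1) *
          (if p.Prime ∧ p ≤ M then p else 1) := by
      refine prod_le_prod' fun p _ ↦ ?_
      by_cases hp : p.Prime
      · by_cases hs : p ≤ s
        · have hpn := Nat.pow_factorization_choose_le (p := p) (k := k) hn
          simp only [hp, hs, and_self, if_true, true_and]
          split_ifs
          · exact hpn.trans (Nat.le_mul_of_pos_right _ hp.pos)
          · simpa using hpn
        · obtain ⟨h1, h2⟩ := h p hp (by omega)
          by_cases hM : p ≤ M
          · simpa [hp, hs, hM] using Nat.pow_le_pow_right hp.pos h1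
          · simp [h2 (by omega), hs, hM]
      · simp [hp, Nat.factorization_eq_zero_of_not_prime]
    _ ≤ n ^ Nat.primeCounting s * primorial M := by
      rw [prod_mul_distrib]
      refine Nat.mul_le_mul ((prod_ite_le (fun _ ↦ n) (fun _ _ ↦ hn) s).trans_eq ?_)
        (prod_ite_le (fun p ↦ p) (fun p hp ↦ hp.pos) M)
      rw [prod_const, ← Nat.primesLE_card_eq_primeCounting, Nat.primesLE_eq_filter_range]

theorem three_mul_primeCounting_le {m : ℕ} (hm : 37 ≤ m) : 3 * Nat.primeCounting m ≤ m := by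
  rcases lt_or_ge m 54 with h | h
  · have small : ∀ m < 54, 37 ≤ m → 3 * Nat.primeCounting m ≤ m := by decide +kernel
    exact small m h hm
  · obtain ⟨j, rfl⟩ := Nat.exists_eq_add_of_le h
    have hj := Nat.primeCounting_add_le (a := 6) (k := 54) (by norm_num) (by norm_num) j
    have h54 : Nat.primeCounting 54 = 16 := by decide +kernel
    have h6 : Nat.totient 6 = 2 := by decide
    rw [h54, h6] at hj
    omega

theorem pow_le_pow_mul_choose {n k : ℕ} (hkn : k ≤ n) : n ^ k ≤ k ^ k * n.choose k := by
  induction k generalizing n with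
  | zero => simp
  | succ k ih =>
    obtain ⟨n, rfl⟩ : ∃ m, n = m + 1 := ⟨n - 1, by omega⟩
    have hkn' : k ≤ n := by omega
    rcases Nat.eq_zero_or_pos k with rfl | hk
    · simp
    have hpow : k ^ k * (n + 1) ^ k ≤ k ^ k * ((k + 1) ^ k * n.choose k) := calc
      k ^ k * (n + 1) ^ k = (k * (n + 1)) ^ k := (mul_pow _ _ _).symm
      _ ≤ ((k + 1) * n) ^ k := Nat.pow_le_pow_left (by nlinarith) k
      _ = (k + 1) ^ k * n ^ k := mul_pow _ _ _
      _ ≤ (k + 1) ^ k * (k ^ k * n.choose k) := Nat.mul_le_mul_left _ (ih hkn')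
      _ = k ^ k * ((k + 1) ^ k * n.choose k) := by ring
    calc
      (n + 1) ^ (k + 1) = (n + 1) ^ k * (n + 1) := pow_succ _ _
      _ ≤ (k + 1) ^ k * n.choose k * (n + 1) :=
        Nat.mul_le_mul_right _ (Nat.le_of_mul_le_mul_left hpow (by positivity))
      _ = (k + 1) ^ k * ((n + 1) * n.choose k) := by ring
      _ = (k + 1) ^ (k + 1) * (n + 1).choose (k + 1) := by
        rw [Nat.add_one_mul_choose_eq]; ring

theorem three_pow_mul_centralBinom_le (k r : ℕ) (hr : r ≤ k) :
    3 ^ r * k.centralBinom ≤ 2 ^ r * (2 * k + r).choose k := by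
  induction r with
  | zero => simp [Nat.centralBinom]
  | succ r ih =>
    have h := Nat.choose_mul_succ_eq (2 * k + r) k
    have h2 : 3 * (2 * k + r).choose k ≤ 2 * (2 * k + (r + 1)).choose k := by
      have hsub : 2 * k + r + 1 - k = k + r + 1 := by omega
      rw [hsub] at h
      refine Nat.le_of_mul_le_mul_right (c := k + r + 1) ?_ (by omega)
      calc
        3 * (2 * k + r).choose k * (k + r + 1)
            = (3 * (k + r + 1)) * (2 * k + r).choose k := by ring
        _ ≤ (2 * (2 * k + r + 1)) * (2 * k + r).choose k := Nat.mul_le_mul_right _ (by omega)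
        _ = 2 * ((2 * k + r).choose k * (2 * k + r + 1)) := by ring
        _ = 2 * (2 * k + (r + 1)).choose k * (k + r + 1) := by rw [h, ← add_assoc]; ring
    calc
      3 ^ (r + 1) * k.centralBinom = 3 * (3 ^ r * k.centralBinom) := by ring
      _ ≤ 3 * (2 ^ r * (2 * k + r).choose k) := Nat.mul_le_mul_left _ (ih (by omega))
      _ = 2 ^ r * (3 * (2 * k + r).choose k) := by ring
      _ ≤ 2 ^ r * (2 * (2 * k + (r + 1)).choose k) := Nat.mul_le_mul_left _ h2
      _ = 2 ^ (r + 1) * (2 * k + (r + 1)).choose k := by ring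

theorem prime_dvd_choose_of_mod_lt {n k q : ℕ} (hq : q.Prime) (hkq : k < q) (h : n % q < k) :
    q ∣ n.choose k := by
  have : Fact q.Prime := ⟨hq⟩
  have hmod := Choose.choose_modEq_choose_mod_mul_choose_div_nat (n := n) (k := k) (p := q)
  rw [Nat.mod_eq_of_lt hkq, Nat.choose_eq_zero_of_lt h, zero_mul] at hmod
  exact (Nat.modEq_zero_iff_dvd).1 hmod

/-- If consecutive entries `a`, `b` of an increasing list satisfy `(b - 1 - a) ^ 3 < a ^ 2`,
then every `n` in its range with `n ^ 2 ≤ k ^ 3` is within `k` above some entry. -/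
theorem exists_mem_le_lt_add_of_isChain {n k : ℕ} (hnk : n ^ 2 ≤ k ^ 3) (l : List ℕ) (a : ℕ)
    (hl : (a :: l).IsChain fun a b ↦ (b - 1 - a) ^ 3 < a ^ 2) (ha : a ≤ n)
    (hlast : n < (a :: l).getLast (List.cons_ne_nil a l)) :
    ∃ q ∈ a :: l, q ≤ n ∧ n < q + k := by
  induction l generalizing a with
  | nil => simp at hlast; omega
  | cons b l ih =>
    rw [List.isChain_cons_cons] at hl
    rcases lt_or_ge n b with hb | hb
    · refine ⟨a, by simp, ha, ?_⟩
      by_contra! hc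
      have h1 : k ^ 3 ≤ (b - 1 - a) ^ 3 := Nat.pow_le_pow_left (by omega) 3
      have h2 : a ^ 2 ≤ n ^ 2 := Nat.pow_le_pow_left ha 2
      omega
    · obtain ⟨q, hq, h⟩ := ih b hl.2 hb (by simpa using hlast)
      exact ⟨q, List.mem_cons_of_mem _ hq, h⟩

/-- An increasing chain of primes in which each gap is at most about the `2 / 3` power of the
smaller entry. -/
def ladderPrimes : List ℕ :=
  [73, 89, 109, 131, 157, 181, 211, 241, 277, 317, 359, 409, 463, 523, 587,
    653, 727, 797, 883, 971, 1069, 1171, 1283, 1399, 1523, 1637, 1759, 1901, 2053, 2213, 2383,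
    2557, 2741, 2927, 3121, 3331, 3547, 3779, 4021, 4273, 4523, 4793, 5077, 5351, 5657, 5953,
    6277, 6607, 6959, 7321, 7699, 8089, 8467, 8867, 9293, 9733, 10181, 10651, 11131, 11621,
    12119, 12647, 13187, 13729, 14303, 14891, 15497, 16111, 16747, 17401, 18061, 18749, 19447,
    20161, 20899, 21649, 22409, 23203, 24007, 24821, 25667, 26513, 27397, 28297, 29221, 30169,
    31139, 32119, 33119]

theorem exists_prime_le_lt_add {n k : ℕ} (hn : 73 ≤ n) (hn' : n < 33119) (hnk : n ^ 2 ≤ k ^ 3) :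
    ∃ q : ℕ, q.Prime ∧ q ≤ n ∧ n < q + k := by
  have hprime : ∀ q ∈ ladderPrimes, Nat.Prime q := by
    simp only [ladderPrimes, List.forall_mem_cons]
    norm_num
  obtain ⟨q, hq, h⟩ := exists_mem_le_lt_add_of_isChain hnk ladderPrimes.tail 73
    (by decide +kernel) hn (show n < ladderPrimes.getLast (List.cons_ne_nil _ _) from hn')
  exact ⟨q, hprime q hq, h⟩

/-- The odd primes less than `210`. -/
def oddPrimesLt210 : List ℕ :=
  [3, 5, 7, 11, 13, 17, 19, 23, 29, 31, 37, 41, 43, 47, 53, 59, 61, 67, 71, 73, 79, 83,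
    89, 97, 101, 103, 107, 109, 113, 127, 131, 137, 139, 149, 151, 157, 163, 167, 173, 179, 181,
    191, 193, 197, 199]

theorem exists_prime_mod_lt_of_lt_37 {n k : ℕ} (hk : 2 ≤ k) (hk' : k < 37) (hkn : 2 * k ≤ n)
    (hn : n < 210) : ∃ q : ℕ, q.Prime ∧ k < q ∧ n % q < k := by
  have hprime : ∀ q ∈ oddPrimesLt210, Nat.Prime q := by
    simp only [oddPrimesLt210, List.forall_mem_cons]
    norm_num
  have hmod : ∀ k < 37, ∀ n < 210, 2 ≤ k → 2 * k ≤ n →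
      ∃ q ∈ oddPrimesLt210, k < q ∧ n % q < k := by
    decide +kernel
  obtain ⟨q, hq, h⟩ := hmod k hk' n hn hk hkn
  exact ⟨q, hprime q hq, h⟩

theorem lt_210_of_pow_le {n k : ℕ} (hk : 2 ≤ k) (hk' : k < 37)
    (h : n ^ k ≤ k ^ k * n ^ Nat.primeCounting k) : n < 210 := by
  have hnum : ∀ k < 37, 2 ≤ k →
      Nat.primeCounting k ≤ k ∧ k ^ k < 210 ^ (k - Nat.primeCounting k) := by decide +kernel
  obtain ⟨hle, hlt⟩ := hnum k hk' hk
  by_contra! hn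
  have hmul : n ^ (k - Nat.primeCounting k) * n ^ Nat.primeCounting k ≤
      k ^ k * n ^ Nat.primeCounting k := by
    rwa [← pow_add, Nat.sub_add_cancel hle]
  have h1 := Nat.le_of_mul_le_mul_right hmul (by positivity)
  have h2 := Nat.pow_le_pow_left hn (k - Nat.primeCounting k)
  omega

theorem sq_le_cube_of_pow_le {n k : ℕ} (hn : 0 < n) (hk : 37 ≤ k)
    (h : n ^ k ≤ k ^ k * n ^ Nat.primeCounting k) : n ^ 2 ≤ k ^ 3 := by
  have hpi := three_mul_primeCounting_le hk
  have hcube : (n ^ 2) ^ k * n ^ k ≤ (k ^ 3) ^ k * n ^ k := calc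
    (n ^ 2) ^ k * n ^ k = (n ^ k) ^ 3 := by ring
    _ ≤ (k ^ k * n ^ Nat.primeCounting k) ^ 3 := Nat.pow_le_pow_left h 3
    _ = (k ^ 3) ^ k * n ^ (3 * Nat.primeCounting k) := by ring
    _ ≤ (k ^ 3) ^ k * n ^ k := Nat.mul_le_mul_left _ (Nat.pow_le_pow_right hn hpi)
  exact (Nat.pow_le_pow_iff_left (by omega)).1 (Nat.le_of_mul_le_mul_right hcube (by positivity))

/-- The case `n < 8 * k` of the numerical estimate. -/
theorem near_inequality_false {n k s r M P : ℕ} (hk : 1024 ≤ k) (hn : 2 * k ≤ n) (hn' : n < 8 * k)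
    (hs : s ^ 2 ≤ n) (hs' : n < (s + 1) ^ 2) (hP : 3 * P ≤ s) (hr : r ≤ k)
    (hM : 3 * M ≤ 2 * k + r)
    (h : 3 ^ r * 4 ^ k ≤ 2 ^ r * (k * (n ^ P * 4 ^ M))) : False := by
  have hk0 : (0 : ℝ) < k := by exact_mod_cast (by omega : 0 < k)
  have hn0 : (0 : ℝ) < n := by exact_mod_cast (by omega : 0 < n)
  have hlog : r * Real.log 3 + k * Real.log 4 ≤
      r * Real.log 2 + (Real.log k + (P * Real.log n + M * Real.log 4)) := by
    have hR : (3 : ℝ) ^ r * 4 ^ k ≤ 2 ^ r * (k * (n ^ P * 4 ^ M)) := by exact_mod_cast h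
    have := Real.log_le_log (by positivity) hR
    rw [Real.log_mul (by positivity) (by positivity), Real.log_mul (by positivity) (by positivity),
      Real.log_mul (by positivity) (by positivity), Real.log_mul (by positivity) (by positivity)]
      at this
    simpa only [Real.log_pow] using this
  have h4 : Real.log 4 = 2 * Real.log 2 := by
    rw [show (4 : ℝ) = 2 ^ 2 by norm_num, Real.log_pow]; norm_num
  have h3 : 3 / 2 * Real.log 2 ≤ Real.log 3 := by
    have : Real.log (2 ^ 3) ≤ Real.log (3 ^ 2) := Real.log_le_log (by norm_num) (by norm_num)
    rw [Real.log_pow, Real.log_pow] at this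
    push_cast at this
    linarith
  have hL1 := Real.log_two_gt_d9
  have hL2 := Real.log_two_lt_d9
  have hkn : Real.log k ≤ Real.log n :=
    Real.log_le_log hk0 (by exact_mod_cast (by omega : k ≤ n))
  have hns : Real.log n ≤ 2 * Real.log (s + 1) := by
    have : Real.log n ≤ Real.log (((s : ℝ) + 1) ^ 2) :=
      Real.log_le_log hn0 (by exact_mod_cast hs'.le)
    rwa [Real.log_pow] at this
  have htan : Real.log (s + 1) ≤ 7 * Real.log 2 + (s + 1) / 128 - 1 := by
    have := Real.log_le_sub_one_of_pos (x := ((s : ℝ) + 1) / 128) (by positivity)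
    rw [Real.log_div (by positivity) (by norm_num), show (128 : ℝ) = 2 ^ 7 by norm_num,
      Real.log_pow] at this
    push_cast at this
    linarith
  have hlogn : 0 ≤ Real.log n := Real.log_natCast_nonneg n
  have hPR : 3 * (P : ℝ) ≤ s := by exact_mod_cast hP
  have hrR : (r : ℝ) ≤ k := by exact_mod_cast hr
  have hMR : 3 * (M : ℝ) ≤ 2 * k + r := by exact_mod_cast hM
  have hkR : (1024 : ℝ) ≤ k := by exact_mod_cast hk
  have hsk : (s : ℝ) ^ 2 ≤ 8 * k := by exact_mod_cast (by omega : s ^ 2 ≤ 8 * k)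
  have hs0 : (0 : ℝ) ≤ s := Nat.cast_nonneg s
  have hmain : k * Real.log 2 / 2 ≤ (1 + s / 3) * Real.log n := by
    have e1 := mul_le_mul_of_nonneg_right hPR hlogn
    have e2 := mul_le_mul_of_nonneg_left h3 (Nat.cast_nonneg (α := ℝ) r)
    have e3 := mul_le_mul_of_nonneg_right hMR (by linarith : 0 ≤ Real.log 2)
    have e4 := mul_le_mul_of_nonneg_right hrR (by linarith : 0 ≤ Real.log 2)
    rw [h4] at hlog
    nlinarith
  have hup : Real.log n ≤ 2 * (4.8521 + (s + 1) / 128 - 1) := by linarith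
  have hmain' : (k : ℝ) * 0.3465 ≤ (1 + s / 3) * (2 * (4.8521 + (s + 1) / 128 - 1)) := by
    have := mul_le_mul_of_nonneg_left hup (by positivity : (0 : ℝ) ≤ 1 + s / 3)
    nlinarith
  rcases le_total (s : ℝ) 90 with h90 | h90 <;> nlinarith

/-- The case `8 * k ≤ n` of the numerical estimate. -/
theorem far_inequality_false {n k s P : ℕ} (hk : 1024 ≤ k) (hn : 8 * k ≤ n) (hnk : n ^ 2 ≤ k ^ 3)
    (hs : s ^ 2 ≤ n) (hP : 3 * P ≤ s) (h : n ^ k ≤ k ^ k * (n ^ P * 4 ^ k)) : False := by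
  have hk0 : (0 : ℝ) < k := by exact_mod_cast (by omega : 0 < k)
  have hn0 : (0 : ℝ) < n := by exact_mod_cast (by omega : 0 < n)
  have hlog : k * Real.log n ≤ k * Real.log k + (P * Real.log n + k * Real.log 4) := by
    have hR : (n : ℝ) ^ k ≤ k ^ k * (n ^ P * 4 ^ k) := by exact_mod_cast h
    have := Real.log_le_log (by positivity) hR
    rw [Real.log_mul (by positivity) (by positivity), Real.log_mul (by positivity) (by positivity)]
      at this
    simpa only [Real.log_pow] using this
  have h4 : Real.log 4 = 2 * Real.log 2 := by
    rw [show (4 : ℝ) = 2 ^ 2 by norm_num, Real.log_pow]; norm_num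
  have hL1 := Real.log_two_gt_d9
  have hL2 := Real.log_two_lt_d9
  have h8 : 3 * Real.log 2 + Real.log k ≤ Real.log n := by
    have : Real.log (2 ^ 3 * k) ≤ Real.log n :=
      Real.log_le_log (by positivity) (by norm_num; exact_mod_cast hn)
    rw [Real.log_mul (by positivity) (by positivity), Real.log_pow] at this
    exact_mod_cast this
  have hlogn : 2 * Real.log n ≤ 3 * Real.log k := by
    have : Real.log ((n : ℝ) ^ 2) ≤ Real.log ((k : ℝ) ^ 3) :=
      Real.log_le_log (by positivity) (by exact_mod_cast hnk)
    rw [Real.log_pow, Real.log_pow] at this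
    exact_mod_cast this
  obtain ⟨y, hy0, hyk⟩ : ∃ y : ℝ, 0 < y ∧ y ^ 4 = k :=
    ⟨√(√k), by positivity, by
      rw [show √(√(k : ℝ)) ^ 4 = (√(√k) ^ 2) ^ 2 by ring, Real.sq_sqrt (by positivity),
        Real.sq_sqrt hk0.le]⟩
  have hlogk : Real.log k = 4 * Real.log y := by
    rw [← hyk, Real.log_pow]; norm_num
  have hsy : (s : ℝ) ≤ y ^ 3 := by
    have hs4 : (s : ℝ) ^ 4 ≤ (k : ℝ) ^ 3 := by
      have : s ^ 4 ≤ k ^ 3 := calc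
        s ^ 4 = (s ^ 2) ^ 2 := by ring
        _ ≤ n ^ 2 := Nat.pow_le_pow_left hs 2
        _ ≤ k ^ 3 := hnk
      exact_mod_cast this
    rw [← hyk, show (y ^ 4) ^ 3 = (y ^ 3) ^ 4 by ring] at hs4
    exact le_of_pow_le_pow_left₀ (by norm_num) (by positivity) hs4
  have hy5 : 5 < y := by
    refine lt_of_pow_lt_pow_left₀ 4 hy0.le ?_
    rw [hyk]
    have : (1024 : ℝ) ≤ k := by exact_mod_cast hk
    norm_num
    linarith
  have htan : Real.log y ≤ 2 * Real.log 2 + y / 4 - 1 := by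
    have := Real.log_le_sub_one_of_pos (x := y / 4) (by positivity)
    rw [Real.log_div (by positivity) (by norm_num), h4] at this
    linarith
  have hlogn0 : 0 ≤ Real.log n := Real.log_natCast_nonneg n
  have hPR : 3 * (P : ℝ) ≤ s := by exact_mod_cast hP
  have hmain : y ^ 3 * (y * Real.log 2) ≤ y ^ 3 * (2 * Real.log y) := by
    have e1 : (P : ℝ) * Real.log n ≤ y ^ 3 / 3 * Real.log n :=
      mul_le_mul_of_nonneg_right (by linarith) hlogn0
    have e2 : y ^ 3 / 3 * Real.log n ≤ y ^ 3 / 3 * (6 * Real.log y) :=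
      mul_le_mul_of_nonneg_left (by linarith) (by positivity)
    have e3 := mul_le_mul_of_nonneg_left h8 hk0.le
    have e4 : y ^ 3 * (y * Real.log 2) = k * Real.log 2 := by rw [← hyk]; ring
    rw [h4] at hlog
    linarith
  have := le_of_mul_le_mul_left hmain (by positivity)
  nlinarith

/-- Binomial coefficients with large `k` and `n ≤ k ^ (3 / 2)` have a prime factor above `k`. -/
theorem exists_prime_dvd_choose_of_sq_le_cube {n k : ℕ} (hk : 1024 ≤ k) (hkn : 2 * k ≤ n)
    (hnk : n ^ 2 ≤ k ^ 3) : ∃ q : ℕ, q.Prime ∧ q ∣ n.choose k ∧ k < q := by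
  by_contra! hsmooth
  have hs := Nat.sqrt_le' n
  have hs' := Nat.lt_succ_sqrt' n
  have hs37 : 37 ≤ n.sqrt := Nat.le_sqrt'.2 (by omega)
  have hP := three_mul_primeCounting_le hs37
  have hchoose : n.choose k ≤ n ^ Nat.primeCounting n.sqrt * 4 ^ min k (n / 3) := by
    refine (choose_le_pow_primeCounting_mul_primorial (s := n.sqrt) (M := min k (n / 3))
      (by omega) (by omega) fun p hp hps ↦ ⟨?_, fun hMp ↦ ?_⟩).trans
      (Nat.mul_le_mul_left _ (primorial_le_four_pow _))
    · exact Nat.factorization_choose_le_one (hs'.trans_le (Nat.pow_le_pow_left hps 2))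
    · rcases le_or_gt p k with hpk | hpk
      · exact Nat.factorization_choose_of_lt_three_mul (by omega) hpk (by omega) (by omega)
      · exact Nat.factorization_eq_zero_of_not_dvd fun hd ↦ (hsmooth p hp hd).not_gt hpk
  rcases lt_or_ge n (8 * k) with h8 | h8
  · refine near_inequality_false (r := min k (n - 2 * k)) (M := min k (n / 3)) hk hkn h8 hs hs' hP
      (by omega) (by omega) ?_
    have hr := three_pow_mul_centralBinom_le k (min k (n - 2 * k)) (by omega)
    have h4 := Nat.four_pow_lt_mul_centralBinom k (by omega)
    have hle : 2 * k + min k (n - 2 * k) ≤ n := by omega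
    generalize min k (n - 2 * k) = r at hr hle ⊢
    calc
      3 ^ r * 4 ^ k ≤ 3 ^ r * (k * k.centralBinom) := Nat.mul_le_mul_left _ h4.le
      _ = k * (3 ^ r * k.centralBinom) := by ring
      _ ≤ k * (2 ^ r * n.choose k) :=
        Nat.mul_le_mul_left _ (hr.trans (Nat.mul_le_mul_left _ (Nat.choose_le_choose k hle)))
      _ = 2 ^ r * (k * n.choose k) := by ring
      _ ≤ _ := by gcongr
  · refine far_inequality_false hk h8 hnk hs hP ?_
    calc
      n ^ k ≤ k ^ k * n.choose k := pow_le_pow_mul_choose (by omega)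
      _ ≤ k ^ k * (n ^ Nat.primeCounting n.sqrt * 4 ^ k) := by
        refine Nat.mul_le_mul_left _ (hchoose.trans (Nat.mul_le_mul_left _ ?_))
        exact Nat.pow_le_pow_right (by norm_num) (min_le_left _ _)

/-- Erdős: for positive integers `k` and `n` with `n ≥ 2k`, the binomial
coefficient `C(n, k)` has a prime divisor greater than `k`. -/
theorem erdos_choose_prime_divisor (k n : ℕ) (hk : 1 ≤ k) (hn : 2 * k ≤ n) :
    ∃ q : ℕ, q.Prime ∧ q ∣ Nat.choose n k ∧ k < q := by
  rcases hk.eq_or_lt with rfl | hk2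
  · exact ⟨n.minFac, Nat.minFac_prime (by omega), by simpa using Nat.minFac_dvd n,
      (Nat.minFac_prime (by omega)).one_lt⟩
  by_contra! hsmooth
  have hmod (q : ℕ) (hq : q.Prime) (hkq : k < q) : ¬ n % q < k := fun h ↦
    (hsmooth q hq (prime_dvd_choose_of_mod_lt hq hkq h)).not_gt hkq
  have hpow : n ^ k ≤ k ^ k * n ^ Nat.primeCounting k := by
    have hle := choose_le_pow_primeCounting_mul_primorial (n := n) (k := k) (s := k) (M := 0)
      (by omega) (by omega) fun p hp hkp ↦ by
        have h0 := Nat.factorization_eq_zero_of_not_dvd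
          fun hd : p ∣ n.choose k ↦ (hsmooth p hp hd).not_gt hkp
        simp [h0]
    rw [primorial_zero, mul_one] at hle
    exact (pow_le_pow_mul_choose (by omega)).trans (Nat.mul_le_mul_left _ hle)
  rcases lt_or_ge k 37 with h37 | h37
  · obtain ⟨q, hq, hkq, hlt⟩ :=
      exists_prime_mod_lt_of_lt_37 hk2 h37 hn (lt_210_of_pow_le hk2 h37 hpow)
    exact hmod q hq hkq hlt
  have hnk := sq_le_cube_of_pow_le (by omega) h37 hpow
  rcases lt_or_ge k 1024 with h1024 | h1024
  · have hlt : n < 33119 := by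
      have : k ^ 3 ≤ 1024 ^ 3 := Nat.pow_le_pow_left h1024.le 3
      by_contra! hc
      have := Nat.pow_le_pow_left hc 2
      omega
    obtain ⟨q, hq, hqn, hnq⟩ := exists_prime_le_lt_add (by omega) hlt hnk
    refine hmod q hq (by omega) ?_
    rw [Nat.mod_eq_sub_mod hqn, Nat.mod_eq_of_lt (by omega)]
    omega
  · obtain ⟨q, hq, hd, hkq⟩ := exists_prime_dvd_choose_of_sq_le_cube h1024 hn hnk
    exact (hsmooth q hq hd).not_gt hkq
end

section
/- Let m ≥ 2 be an integer and let H be a proper subgroup of the multiplicative group (ℤ/mℤ)ˣ of units modulo m. Then there exist infinitely many primes p, coprime to m, such that the residue class of p modulo m (viewed as a unit of ℤ/mℤ) does not lie in H. -/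
/-- Granville: if `H` is a proper subgroup of the multiplicative group of units
modulo `m`, then there are infinitely many primes `p`, coprime to `m`, whose
residue class modulo `m` does not lie in `H`. -/
theorem granville_primes_outside_subgroup (m : ℕ) (hm : 2 ≤ m)
    (H : Subgroup (ZMod m)ˣ) (hH : H ≠ ⊤) :
    {p : ℕ | ∃ (hp : p.Prime) (h : Nat.Coprime p m),
      ZMod.unitOfCoprime p h ∉ H}.Infinite := by
  have : NeZero m := ⟨by omega⟩
  obtain ⟨u, hu⟩ : ∃ u, u ∉ H := by
    simpa [Subgroup.eq_top_iff'] using hH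
  refine (Nat.infinite_setOfPred_prime_and_eq_mod u.isUnit).mono ?_
  rintro p ⟨hp, hpu⟩
  have hpm : p.Coprime m := (ZMod.isUnit_iff_coprime p m).mp (hpu ▸ u.isUnit)
  have hunit : ZMod.unitOfCoprime p hpm = u := Units.ext hpu
  exact ⟨hp, hpm, hunit ▸ hu⟩
end

section
/- Fix a positive integer k, and define a sequence (a_n) of positive integers by a₁ = k + 1 and a_{n+1} = a_n² − k·a_n + k for n ≥ 1. Then the terms of the sequence are pairwise relatively prime: for all m ≠ n, gcd(a_m, a_n) = 1. -/
lemma rec_eq_mul_sub_add {k : ℕ} {a : ℕ → ℕ}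
    (hrec : ∀ n, 1 ≤ n → a (n + 1) = a n ^ 2 - k * a n + k) {n : ℕ} (hn : 1 ≤ n) :
    a (n + 1) = a n * (a n - k) + k := by
  rw [hrec n hn, Nat.mul_sub, sq, mul_comm k]

lemma lt_and_coprime_of_rec {k : ℕ} {a : ℕ → ℕ} (h1 : a 1 = k + 1)
    (hrec : ∀ n, 1 ≤ n → a (n + 1) = a n ^ 2 - k * a n + k) {n : ℕ} (hn : 1 ≤ n) :
    k < a n ∧ Nat.Coprime (a n) k := by
  induction n, hn using Nat.le_induction with
  | base => simp [h1]
  | succ n hn ih =>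
    obtain ⟨hlt, hco⟩ := ih
    rw [rec_eq_mul_sub_add hrec hn]
    refine ⟨Nat.lt_add_of_pos_left (Nat.mul_pos (by omega) (by omega)), ?_⟩
    rw [Nat.coprime_add_self_left]
    exact hco.mul_left ((Nat.coprime_sub_self_left hlt.le).2 hco)

lemma dvd_sub_of_rec {k : ℕ} {a : ℕ → ℕ}
    (hrec : ∀ n, 1 ≤ n → a (n + 1) = a n ^ 2 - k * a n + k) {m n : ℕ} (hm : 1 ≤ m)
    (hmn : m < n) : a m ∣ a n - k := by
  induction n, hmn using Nat.le_induction with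
  | base => simp [rec_eq_mul_sub_add hrec hm]
  | succ n hn ih =>
    rw [rec_eq_mul_sub_add hrec (by omega), Nat.add_sub_cancel]
    exact ih.mul_left _

lemma coprime_of_rec_of_lt {k : ℕ} {a : ℕ → ℕ} (h1 : a 1 = k + 1)
    (hrec : ∀ n, 1 ≤ n → a (n + 1) = a n ^ 2 - k * a n + k) {m n : ℕ} (hm : 1 ≤ m)
    (hmn : m < n) : Nat.Coprime (a m) (a n) := by
  obtain ⟨c, hc⟩ := dvd_sub_of_rec hrec hm hmn
  have hlt := (lt_and_coprime_of_rec h1 hrec (hm.trans hmn.le)).1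
  rw [show a n = k + a m * c by omega, Nat.coprime_add_mul_left_right]
  exact (lt_and_coprime_of_rec h1 hrec hm).2

/-- The terms of the sequence `a₁ = k + 1`, `a_{n+1} = a_n² − k·a_n + k` are
pairwise relatively prime. -/
theorem mohanty_sylvester_pairwise_coprime (k : ℕ) (hk : 0 < k) (a : ℕ → ℕ)
    (h1 : a 1 = k + 1) (hrec : ∀ n, 1 ≤ n → a (n + 1) = a n ^ 2 - k * a n + k) :
    ∀ m n, 1 ≤ m → 1 ≤ n → m ≠ n → Nat.gcd (a m) (a n) = 1 := by
  intro m n hm hn hmn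
  rcases hmn.lt_or_gt with h | h
  · exact coprime_of_rec_of_lt h1 hrec hm h
  · exact (coprime_of_rec_of_lt h1 hrec hn h).symm
end

section
/- For every positive integer n, the number 2^(2^(n+1)) + 2^(2ⁿ) + 1 has at least n distinct prime factors. -/
theorem Nat.card_primeFactors_sq_sq_add_sq_add_one {x : ℕ} (hx : Even x) (hx0 : x ≠ 0) :
    (x ^ 2 + x + 1).primeFactors.card + 1 ≤
      ((x ^ 2) ^ 2 + x ^ 2 + 1).primeFactors.card := by
  obtain ⟨y, rfl⟩ : ∃ y, x = y + 1 := Nat.exists_eq_succ_of_ne_zero hx0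
  have hfac : ((y + 1) ^ 2) ^ 2 + (y + 1) ^ 2 + 1 =
      ((y + 1) ^ 2 + (y + 1) + 1) * ((y + 1) * y + 1) := by ring
  have hy : 0 < y := by
    obtain ⟨k, hk⟩ := hx
    omega
  have hcx : Nat.Coprime ((y + 1) * y + 1) (y + 1) := by simp
  have hc2 : Nat.Coprime ((y + 1) * y + 1) 2 :=
    (hx.mul_right y).add_one.coprime_two_right
  have hcop : Nat.Coprime ((y + 1) ^ 2 + (y + 1) + 1) ((y + 1) * y + 1) := by
    have h : (y + 1) ^ 2 + (y + 1) + 1 = 2 * (y + 1) + ((y + 1) * y + 1) := by ring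
    rw [h, Nat.coprime_add_self_left]
    exact (hc2.mul_right hcx).symm
  have hpos : 0 < ((y + 1) * y + 1).primeFactors.card := by
    rw [Finset.card_pos, Nat.nonempty_primeFactors]
    have : 0 < (y + 1) * y := Nat.mul_pos y.succ_pos hy
    exact Nat.succ_lt_succ this
  rw [hfac, hcop.primeFactors_mul, Finset.card_union_of_disjoint hcop.disjoint_primeFactors]
  omega

/-- For every positive integer `n`, the number `2^(2^(n+1)) + 2^(2ⁿ) + 1`
has at least `n` distinct prime factors. -/
theorem many_prime_factors (n : ℕ) (hn : 1 ≤ n) :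
    n ≤ (Nat.primeFactors (2 ^ (2 ^ (n + 1)) + 2 ^ (2 ^ n) + 1)).card := by
  clear hn
  induction n with
  | zero => exact Nat.zero_le _
  | succ n ih =>
    have h := Nat.card_primeFactors_sq_sq_add_sq_add_one (x := 2 ^ 2 ^ n)
      (Nat.even_pow.2 ⟨even_two, by positivity⟩) (by positivity)
    simp only [← pow_mul, ← pow_succ] at h
    omega
end

section
/- Let c be a fixed positive integer and let (a_n) be a sequence of positive integers satisfying a_n < a_{n+1} ≤ a_n + c for every n ≥ 1. Then the set of primes dividing at least one term of the sequence is infinite. -/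
open Nat in
/-- A strictly increasing sequence all of whose terms are `k`-smooth cannot grow linearly. -/
theorem not_forall_mem_smoothNumbers_of_linear_bound (k c d : ℕ) (b : ℕ → ℕ)
    (hb : StrictMono b) (hle : ∀ n, b n ≤ d + c * n) :
    ¬ ∀ n, b n ∈ smoothNumbers k := by
  intro hsmooth
  set K := 2 ^ k.primesBelow.card with hK
  have key (m : ℕ) : m + 1 ≤ K * sqrt (d + c * m) := by
    calc m + 1 = ((Finset.range (m + 1)).image b).card := by
          rw [Finset.card_image_of_injective _ hb.injective, Finset.card_range]
      _ ≤ (smoothNumbersUpTo (d + c * m) k).card := by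
          refine Finset.card_le_card fun x hx ↦ ?_
          obtain ⟨n, hn, rfl⟩ := Finset.mem_image.mp hx
          have hnm : n ≤ m := by simpa [Nat.lt_succ_iff] using hn
          exact mem_smoothNumbersUpTo.mpr
            ⟨(hle n).trans (by gcongr), hsmooth n⟩
      _ ≤ K * sqrt (d + c * m) := smoothNumbersUpTo_card_le _ _
  set m := K ^ 2 * (d + c) with hm
  have hsq : (m + 1) ^ 2 ≤ m * (m + 1) :=
    calc (m + 1) ^ 2 ≤ (K * sqrt (d + c * m)) ^ 2 := by gcongr; exact key m
      _ = K ^ 2 * sqrt (d + c * m) ^ 2 := mul_pow _ _ _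
      _ ≤ K ^ 2 * (d + c * m) := by gcongr; exact sqrt_le' _
      _ ≤ K ^ 2 * ((d + c) * (m + 1)) := by gcongr; nlinarith [Nat.zero_le (d * m)]
      _ = m * (m + 1) := by rw [← mul_assoc, ← hm]
  nlinarith

/-- Baronov: if `(a_n)` is a sequence of positive integers with
`a_n < a_{n+1} ≤ a_n + c` for every `n ≥ 1`, then the set of primes dividing
at least one term of the sequence is infinite. -/
theorem baronov_bounded_gaps_prime_divisors (c : ℕ) (hc : 0 < c) (a : ℕ → ℕ)
    (hpos : ∀ n, 1 ≤ n → 0 < a n)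
    (hmono : ∀ n, 1 ≤ n → a n < a (n + 1))
    (hgap : ∀ n, 1 ≤ n → a (n + 1) ≤ a n + c) :
    {p : ℕ | p.Prime ∧ ∃ n, 1 ≤ n ∧ p ∣ a n}.Infinite := by
  intro hfin
  obtain ⟨B, hB⟩ := hfin.bddAbove
  refine not_forall_mem_smoothNumbers_of_linear_bound (B + 1) c (a 1) (fun n ↦ a (n + 1))
    (strictMono_nat_of_lt_succ fun n ↦ hmono (n + 1) n.succ_pos) (fun n ↦ ?_) fun n ↦ ?_
  · induction n with
    | zero => simp
    | succ n ih =>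
      have := hgap (n + 1) n.succ_pos
      rw [mul_add_one]
      omega
  · refine Nat.mem_smoothNumbers'.mpr fun p hp hdvd ↦ ?_
    exact Nat.lt_succ_of_le (hB ⟨hp, n + 1, n.succ_pos, hdvd⟩)
end

section
/- If m and n are positive integers such that m > n^(n−1), then there exist n distinct primes p₁, p₂, …, p_n such that p_i divides m + i for each i = 1, 2, …, n. -/
/-- A number exceeding `b ^ k` with at most `k` prime factors has an exact prime power divisor
exceeding `b`. -/
theorem Nat.exists_lt_primePow_of_pow_lt {b k N : ℕ} (hb : 0 < b) (hN : b ^ k < N)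
    (hk : N.primeFactors.card ≤ k) :
    ∃ p ∈ N.primeFactors, b < p ^ N.factorization p := by
  by_contra! hc
  have hprod : ∏ p ∈ N.primeFactors, p ^ N.factorization p = N :=
    Nat.prod_factorization_pow_eq_self (by omega)
  have hle : N ≤ b ^ k := calc
    N = ∏ p ∈ N.primeFactors, p ^ N.factorization p := hprod.symm
    _ ≤ b ^ N.primeFactors.card := Finset.prod_le_pow_card _ _ _ hc
    _ ≤ b ^ k := Nat.pow_le_pow_right hb hk
  omega

/-- If powers of `p`, both at least `n`, divide `m + i + 1` and `m + j + 1`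
with `i, j < n`, then `i = j`. -/
theorem Fin.eq_of_pow_dvd_add {m n p a b : ℕ} {i j : Fin n}
    (ha : n ≤ p ^ a) (hb : n ≤ p ^ b)
    (hi : p ^ a ∣ m + (i : ℕ) + 1) (hj : p ^ b ∣ m + (j : ℕ) + 1) : i = j := by
  wlog hab : a ≤ b generalizing i j a b
  · exact (this hb ha hj hi (by omega)).symm
  have hmod : (i : ℕ) ≡ j [MOD p ^ a] := by
    have h : m + (i : ℕ) + 1 ≡ m + (j : ℕ) + 1 [MOD p ^ a] :=
      ((Nat.modEq_zero_iff_dvd.2 hi).trans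
        (Nat.modEq_zero_iff_dvd.2 ((pow_dvd_pow p hab).trans hj)).symm)
    exact (h.add_right_cancel' 1).add_left_cancel' m
  exact Fin.ext (hmod.eq_of_lt_of_lt (i.2.trans_le ha) (j.2.trans_le ha))

/-- Hall's theorem for a family of `n` finsets in which the members with fewer than `n` elements
have distinct representatives. -/
theorem Finset.exists_injective_mem_of_injOn {α : Type*} [DecidableEq α] {n : ℕ}
    (t : Fin n → Finset α) (q : Fin n → α) (hq : ∀ i, (t i).card < n → q i ∈ t i)
    (hinj : Set.InjOn q {i | (t i).card < n}) :
    ∃ f : Fin n → α, Function.Injective f ∧ ∀ i, f i ∈ t i := by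
  refine (Finset.all_card_le_biUnion_card_iff_exists_injective t).1 fun s => ?_
  by_cases hs : ∃ i ∈ s, n ≤ (t i).card
  · obtain ⟨i, his, hi⟩ := hs
    calc s.card ≤ n := by simpa using s.card_le_univ
      _ ≤ (t i).card := hi
      _ ≤ (s.biUnion t).card := Finset.card_le_card (Finset.subset_biUnion_of_mem t his)
  · push Not at hs
    refine Finset.card_le_card_of_injOn q (fun i hi => ?_) (hinj.mono hs)
    exact Finset.mem_biUnion.2 ⟨i, hi, hq i (hs i hi)⟩

/-- Baronov: if `m > n^(n−1)` with `m, n` positive, then there exist `n`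
distinct primes `p₁, …, p_n` with `p_i ∣ m + i` for each `i`. -/
theorem baronov_distinct_prime_divisors (m n : ℕ) (hm : 0 < m) (hn : 0 < n)
    (h : n ^ (n - 1) < m) :
    ∃ p : Fin n → ℕ, Function.Injective p ∧
      ∀ i : Fin n, (p i).Prime ∧ p i ∣ m + (i : ℕ) + 1 := by
  have hex : ∀ i : Fin n, ∃ p, (m + (i : ℕ) + 1).primeFactors.card < n →
      p ∈ (m + (i : ℕ) + 1).primeFactors ∧ n < p ^ (m + (i : ℕ) + 1).factorization p := by
    intro i
    by_cases hi : (m + (i : ℕ) + 1).primeFactors.card < n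
    · obtain ⟨p, hp⟩ := Nat.exists_lt_primePow_of_pow_lt (N := m + (i : ℕ) + 1) hn
        (by omega) (Nat.le_sub_one_of_lt hi)
      exact ⟨p, fun _ => hp⟩
    · exact ⟨0, fun hi' => absurd hi' hi⟩
  choose q hq using hex
  obtain ⟨f, hf, hmem⟩ := Finset.exists_injective_mem_of_injOn
    (fun i : Fin n => (m + (i : ℕ) + 1).primeFactors) q (fun i hi => (hq i hi).1)
    (fun i hi j hj hij => by
      have hj' := (hq j hj).2
      have hdvd := Nat.ordProj_dvd (m + (j : ℕ) + 1) (q j)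
      rw [← hij] at hj' hdvd
      exact Fin.eq_of_pow_dvd_add (hq i hi).2.le hj'.le (Nat.ordProj_dvd _ _) hdvd)
  exact ⟨f, hf, fun i =>
    ⟨Nat.prime_of_mem_primeFactors (hmem i), Nat.dvd_of_mem_primeFactors (hmem i)⟩⟩
end

section
/- There exist infinitely many positive integers n such that n² + 1 has a prime divisor greater than 2n + √(2n). -/
/-- A prime `p ≡ 1 [MOD 4]` divides `n ^ 2 + 1` for some `n < p / 2`. -/
theorem Nat.Prime.exists_two_mul_lt_dvd_sq_add_one {p : ℕ} (hp : p.Prime) (hp1 : p % 4 = 1) :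
    ∃ n : ℕ, 2 * n < p ∧ p ∣ n ^ 2 + 1 := by
  have : Fact p.Prime := ⟨hp⟩
  obtain ⟨y, hy⟩ : IsSquare (-1 : ZMod p) := ZMod.exists_sq_eq_neg_one_iff.mpr (by omega)
  refine ⟨y.valMinAbs.natAbs, ?_, ?_⟩
  · have := ZMod.natAbs_valMinAbs_le y
    omega
  · rw [← Int.natCast_dvd_natCast, ← ZMod.intCast_zmod_eq_zero_iff_dvd]
    push_cast
    rw [← Int.cast_pow, sq_abs, Int.cast_pow, ZMod.coe_valMinAbs,
      sq, ← hy, neg_add_cancel]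

/-- If `p > 20` divides `n ^ 2 + 1` and `2 * n < p`, then `2 * n + √(2 * n) < p`. -/
theorem two_mul_add_sqrt_lt_of_dvd_sq_add_one {p n : ℕ} (hp : 20 < p) (hlt : 2 * n < p)
    (hdvd : p ∣ n ^ 2 + 1) : (2 * n : ℝ) + Real.sqrt (2 * n) < p := by
  obtain ⟨k, rfl⟩ := Nat.exists_eq_add_of_lt hlt
  have hk : 2 * n + k + 1 ∣ (k + 1) ^ 2 + 4 := by
    zify at hdvd ⊢
    have h : ((k : ℤ) + 1) ^ 2 + 4 =
        (2 * n + k + 1) * (k + 1 - 2 * n) + 4 * (n ^ 2 + 1) := by ring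
    rw [h]
    exact dvd_add (dvd_mul_right _ _) (hdvd.mul_left 4)
  have hle := Nat.le_of_dvd (by positivity) hk
  have hk4 : 4 ≤ k := by
    by_contra! h
    nlinarith
  have hsq : 2 * n < (k + 1) ^ 2 := by nlinarith
  have hsqrt : Real.sqrt (2 * n) < k + 1 := by
    rw [Real.sqrt_lt' (by positivity)]
    exact_mod_cast hsq
  push_cast
  linarith

/-- IMO 2008 Problem 3: there are infinitely many positive integers `n` such
that `n² + 1` has a prime divisor greater than `2n + √(2n)`. -/
theorem imo2008_q3 :
    {n : ℕ | 0 < n ∧ ∃ p : ℕ, p.Prime ∧ p ∣ n ^ 2 + 1 ∧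
      (2 * n : ℝ) + Real.sqrt (2 * n) < p}.Infinite := by
  refine Set.infinite_of_forall_exists_gt fun N => ?_
  obtain ⟨p, hp, hpN, hp1⟩ := Nat.exists_prime_gt_modEq_one (N ^ 2 + 20) four_ne_zero
  obtain ⟨n, hlt, hdvd⟩ := hp.exists_two_mul_lt_dvd_sq_add_one hp1
  have hle := Nat.le_of_dvd (by positivity) hdvd
  have hNn : N < n := lt_of_pow_lt_pow_left₀ 2 n.zero_le (by omega)
  exact ⟨n, ⟨by omega, p, hp, hdvd,
    two_mul_add_sqrt_lt_of_dvd_sq_add_one (by nlinarith) hlt hdvd⟩, hNn⟩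
end
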